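/- Define f_n(x) = ∑_{k=1}^{n} |sin(kπx)|/k. For every rational p/q in lowest terms with q ≥ 1 and every n ≥ q²/2, f_n has a strict local minimum at x = p/q. -/

import Mathlib

noncomputable def f (n : ℕ) (x : ℝ) : ℝ :=
  ∑ k ∈ Finset.Icc 1 n, |Real.sin (k * Real.pi * x)| / k

open Filter Topology Asymptotics

/-- First-order expansion of the absolute value of a differentiable function, with a corner
at the zeros of the function. -/
lemma HasDerivAt.abs_expansion_isLittleO {F : ℝ → ℝ} {F' a : ℝ} (hF : HasDerivAt F F' a) :
    (fun x => |F x| - |F a| - (F' * Real.sign (F a) * (x - a)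
      + if F a = 0 then |F'| * |x - a| else 0)) =o[𝓝 a] fun x => x - a := by
  have h := hF.isLittleO
  simp only [smul_eq_mul] at h
  rcases lt_trichotomy (F a) 0 with h0 | h0 | h0
  · refine (h.neg_left).congr' ?_ EventuallyEq.rfl
    filter_upwards [hF.continuousAt.eventually_lt_const h0] with x hx
    rw [abs_of_neg hx, abs_of_neg h0, Real.sign_of_neg h0, if_neg h0.ne]
    ring
  · refine IsBigO.trans_isLittleO (IsBigO.of_bound 1 (Eventually.of_forall fun x => ?_)) h
    simp only [h0, Real.sign_zero, if_true, Real.norm_eq_abs, one_mul, abs_zero, sub_zero,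
      mul_zero, zero_mul, zero_add]
    rw [← abs_mul, mul_comm F']
    exact abs_abs_sub_abs_le_abs_sub _ _
  · refine h.congr' ?_ EventuallyEq.rfl
    filter_upwards [hF.continuousAt.eventually_const_lt h0] with x hx
    rw [abs_of_pos hx, abs_of_pos h0, Real.sign_of_pos h0, if_neg h0.ne']
    ring

/-- The derivative of `|sin|` away from its zeros, and `0` at them. -/
noncomputable def cosSignSin (θ : ℝ) : ℝ := Real.cos θ * Real.sign (Real.sin θ)

lemma cosSignSin_periodic : Function.Periodic cosSignSin Real.pi := fun θ => by
  simp [cosSignSin, Real.cos_add_pi, Real.sin_add_pi, Real.sign_neg]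

lemma cosSignSin_neg (θ : ℝ) : cosSignSin (-θ) = -cosSignSin θ := by
  simp [cosSignSin, Real.sign_neg]

lemma abs_cosSignSin_lt_one (θ : ℝ) : |cosSignSin θ| < 1 := by
  unfold cosSignSin
  by_cases h : Real.sin θ = 0
  · simp [h]
  · have hc : |Real.cos θ| < 1 := by
      rw [← sq_lt_one_iff_abs_lt_one]
      have := Real.sin_sq_add_cos_sq θ
      have := sq_pos_of_ne_zero h
      linarith
    rcases Real.sign_apply_eq_of_ne_zero _ h with hs | hs <;> simpa [hs] using hc

lemma abs_sum_range_lt {h : ℕ → ℝ} (hh : ∀ k, |h k| < 1) {N : ℕ} (hN : 0 < N) :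
    |∑ k ∈ Finset.range N, h k| < N := by
  calc |∑ k ∈ Finset.range N, h k| ≤ ∑ k ∈ Finset.range N, |h k| := Finset.abs_sum_le_sum_abs _ _
    _ < ∑ _k ∈ Finset.range N, (1 : ℝ) :=
        Finset.sum_lt_sum_of_nonempty ⟨0, by simpa using hN⟩ fun k _ => hh k
    _ = N := by simp

lemma sum_range_eq_zero_of_antisymm {g : ℕ → ℝ} {q : ℕ}
    (hanti : ∀ k ≤ q, g (q - k) = -g k) (hg0 : g 0 = 0) :
    ∑ k ∈ Finset.range q, g k = 0 := by
  have hrefl := Finset.sum_range_reflect g (q + 1)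
  have hneg : ∑ k ∈ Finset.range (q + 1), g (q + 1 - 1 - k)
      = -∑ k ∈ Finset.range (q + 1), g k := by
    rw [← Finset.sum_neg_distrib]
    refine Finset.sum_congr rfl fun k hk => ?_
    rw [Nat.add_sub_cancel]
    exact hanti k (Nat.lt_succ_iff.mp (Finset.mem_range.mp hk))
  have hgq : g q = 0 := by simpa [hg0] using hanti 0 (Nat.zero_le q)
  have hsucc := Finset.sum_range_succ g q
  linarith

/-- Over a period, an antisymmetric sequence with terms of absolute value less than one has
initial sums bounded by the number of terms on the shorter side. -/
lemma abs_sum_range_lt_of_antisymm {g : ℕ → ℝ} {q m r : ℕ} (hr : r < q)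
    (hanti : ∀ k ≤ q, g (q - k) = -g k) (hg0 : g 0 = 0) (hg : ∀ k, |g k| < 1)
    (hm : 0 < m) (hqm : q ≤ 2 * m + 1) :
    |∑ k ∈ Finset.range (r + 1), g k| < m := by
  have bound : ∀ (h : ℕ → ℝ) (N : ℕ), (∀ k, |h k| < 1) → N ≤ m →
      |∑ k ∈ Finset.range N, h k| < m := by
    intro h N hh hN
    rcases Nat.eq_zero_or_pos N with rfl | hN0
    · simpa using hm
    · exact (abs_sum_range_lt hh hN0).trans_le (by exact_mod_cast hN)
  rcases le_or_gt r m with hrm | hrm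
  · rw [Finset.sum_range_succ', hg0, add_zero]
    exact bound (fun k => g (k + 1)) r (fun k => hg _) hrm
  · have htotal := sum_range_eq_zero_of_antisymm hanti hg0
    rw [show q = r + 1 + (q - 1 - r) by omega, Finset.sum_range_add] at htotal
    rw [eq_neg_of_add_eq_zero_left htotal, abs_neg]
    exact bound (fun k => g (r + 1 + k)) _ (fun k => hg _) (by omega)

lemma sum_range_add_mul_period {g : ℕ → ℝ} {q : ℕ} (hper : Function.Periodic g q)
    (hsum : ∑ k ∈ Finset.range q, g k = 0) (m r : ℕ) :
    ∑ k ∈ Finset.range (q * m + r), g k = ∑ k ∈ Finset.range r, g k := by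
  induction m with
  | zero => simp
  | succ m ih =>
    rw [show q * (m + 1) + r = q + (q * m + r) by ring, Finset.sum_range_add, hsum, zero_add, ← ih]
    refine Finset.sum_congr rfl fun k _ => ?_
    rw [add_comm, hper]

lemma sin_mul_pi_mul_div_eq_zero_iff {p : ℤ} {q : ℕ} (hq : 1 ≤ q) (hpq : Int.gcd p q = 1) (k : ℕ) :
    Real.sin (k * Real.pi * ((p : ℝ) / q)) = 0 ↔ q ∣ k := by
  have hq0 : (q : ℝ) ≠ 0 := by positivity
  rw [Real.sin_eq_zero_iff]
  constructor
  · rintro ⟨z, hz⟩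
    have hzq : (z : ℝ) * q = k * p := by
      have hpi := Real.pi_ne_zero
      field_simp at hz
      linarith
    have hzq' : z * q = k * p := by exact_mod_cast hzq
    have hdvd : (q : ℤ) ∣ k * p := ⟨z, by rw [← hzq', mul_comm]⟩
    have hcop : IsCoprime (q : ℤ) p := (Int.isCoprime_iff_gcd_eq_one.mpr hpq).symm
    exact_mod_cast hcop.dvd_of_dvd_mul_right hdvd
  · rintro ⟨c, rfl⟩
    refine ⟨c * p, ?_⟩
    push_cast
    field_simp

/-- The regular part of the slope of `f n` at `p / q` is smaller than the corner part. -/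
lemma abs_sum_cosSignSin_lt (p : ℤ) {q n : ℕ} (hq : 1 ≤ q) (hn : q ^ 2 ≤ 2 * n) :
    |∑ k ∈ Finset.Icc 1 n, cosSignSin (k * Real.pi * ((p : ℝ) / q))| < (n / q : ℕ) := by
  have hq0 : (q : ℝ) ≠ 0 := by positivity
  set g : ℕ → ℝ := fun k => cosSignSin (k * Real.pi * ((p : ℝ) / q)) with hgdef
  have hg0 : g 0 = 0 := by simp [hgdef, cosSignSin]
  have hper : Function.Periodic g q := fun k => by
    simp only [hgdef]
    rw [← cosSignSin_periodic.int_mul p (k * Real.pi * ((p : ℝ) / q))]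
    congr 1
    push_cast
    field_simp
  have hanti : ∀ k ≤ q, g (q - k) = -g k := fun k hk => by
    simp only [hgdef]
    rw [← cosSignSin_neg, ← cosSignSin_periodic.int_mul p (-(k * Real.pi * ((p : ℝ) / q)))]
    congr 1
    push_cast [hk]
    field_simp
    ring
  have hIcc : ∑ k ∈ Finset.Icc 1 n, g k = ∑ k ∈ Finset.range (n + 1), g k := by
    rw [Finset.range_eq_Ico, Finset.sum_eq_sum_Ico_succ_bot (Nat.succ_pos n), hg0, zero_add]
    rfl
  have hdiv := Nat.div_add_mod n q
  have hmod := Nat.mod_lt n hq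
  have hqm : q ≤ 2 * (n / q) + 1 := by
    by_contra! hlt
    nlinarith
  have hm : 0 < n / q := by
    refine Nat.div_pos ?_ hq
    rcases Nat.lt_or_ge q 2 with h2 | h2 <;> nlinarith
  rw [hIcc, ← hdiv, add_assoc,
    sum_range_add_mul_period hper (sum_range_eq_zero_of_antisymm hanti hg0), hdiv]
  exact abs_sum_range_lt_of_antisymm hmod hanti hg0 (fun k => abs_cosSignSin_lt_one _) hm hqm

/-- First-order expansion of `f n` at a rational point. -/
lemma f_expansion_isLittleO {p : ℤ} {q : ℕ} (hq : 1 ≤ q) (hpq : Int.gcd p q = 1) (n : ℕ) :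
    (fun x => f n x - f n ((p : ℝ) / q)
      - Real.pi * ((∑ k ∈ Finset.Icc 1 n, cosSignSin (k * Real.pi * ((p : ℝ) / q)))
          * (x - (p : ℝ) / q) + (n / q : ℕ) * |x - (p : ℝ) / q|))
      =o[𝓝 ((p : ℝ) / q)] fun x => x - (p : ℝ) / q := by
  set a : ℝ := (p : ℝ) / q with ha
  have hcard : ∑ k ∈ Finset.Icc 1 n, (if q ∣ k then (1 : ℝ) else 0) = (n / q : ℕ) := by
    rw [Finset.sum_boole, ← Nat.Ioc_filter_dvd_card_eq_div]
    rfl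
  have hterm : ∀ k ∈ Finset.Icc 1 n,
      (fun x => |Real.sin (k * Real.pi * x)| / k - |Real.sin (k * Real.pi * a)| / k
        - Real.pi * (cosSignSin (k * Real.pi * a) * (x - a)
          + (if q ∣ k then 1 else 0) * |x - a|)) =o[𝓝 a] fun x => x - a := by
    intro k hk
    have hk0 : (k : ℝ) ≠ 0 := by
      have := (Finset.mem_Icc.mp hk).1
      positivity
    have hderiv : HasDerivAt (fun x => Real.sin (k * Real.pi * x))
        (Real.cos (k * Real.pi * a) * (k * Real.pi)) a := by
      simpa using ((hasDerivAt_id a).const_mul (k * Real.pi)).sin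
    refine (hderiv.abs_expansion_isLittleO.const_mul_left (k : ℝ)⁻¹).congr_left fun x => ?_
    simp only [ha, sin_mul_pi_mul_div_eq_zero_iff hq hpq k]
    rw [← ha]
    unfold cosSignSin
    split_ifs with hdvd
    · have hs := (sin_mul_pi_mul_div_eq_zero_iff hq hpq k).mpr hdvd
      rw [← ha] at hs
      have hc : |Real.cos (k * Real.pi * a)| = 1 :=
        Real.abs_cos_eq_one_iff.mpr (by simpa [eq_comm] using Real.sin_eq_zero_iff.mp hs)
      rw [abs_mul, hc, abs_of_nonneg (by positivity : (0 : ℝ) ≤ k * Real.pi)]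
      field_simp
    · field_simp
      ring
  refine (IsLittleO.sum hterm).congr_left fun x => ?_
  simp only [f, ← hcard, Finset.sum_apply, Finset.sum_sub_distrib, ← Finset.mul_sum,
    Finset.sum_add_distrib, ← Finset.sum_mul]

theorem stmt_8 (p : ℤ) (q : ℕ) (hq : 1 ≤ q) (hpq : Int.gcd p q = 1)
    (n : ℕ) (hn : (q : ℝ) ^ 2 / 2 ≤ n) :
    ∃ δ > 0, ∀ x : ℝ, 0 < |x - (p : ℝ) / q| → |x - (p : ℝ) / q| < δ →
      f n ((p : ℝ) / q) < f n x := by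
  have hn' : q ^ 2 ≤ 2 * n := by
    have : (q : ℝ) ^ 2 ≤ 2 * n := by linarith
    exact_mod_cast this
  have hslope := abs_sum_cosSignSin_lt p hq hn'
  have hexp := f_expansion_isLittleO hq hpq n
  set S := ∑ k ∈ Finset.Icc 1 n, cosSignSin (k * Real.pi * ((p : ℝ) / q))
  have hgap : 0 < Real.pi * ((n / q : ℕ) - |S|) / 2 := by
    have := sub_pos.mpr hslope
    positivity
  obtain ⟨δ, hδ, hball⟩ := Metric.eventually_nhds_iff.mp (hexp.bound hgap)
  refine ⟨δ, hδ, fun x hx0 hxδ => ?_⟩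
  have hx := hball (y := x) (by rwa [Real.dist_eq])
  rw [Real.norm_eq_abs, Real.norm_eq_abs] at hx
  have hlow := (abs_le.mp hx).1
  have hS : -(|S| * |x - (p : ℝ) / q|) ≤ S * (x - (p : ℝ) / q) := by
    rw [← abs_mul]
    exact neg_abs_le _
  have hSpi := mul_le_mul_of_nonneg_left hS Real.pi_pos.le
  have hpos := mul_pos hgap hx0
  nlinarith
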